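/- There exist constants δ, D > 0 and a positive integer Q such that the following holds for Thompson's group V. For every g ∈ V with N(g) ≥ 4 there is a word w in the letters {x0^{±1}, x1^{±1}, c1^{±1}, π0^{±1}} of length at most D·|g|_C such that g·w = x0^{Q·|g|_C}·x1^{−1}·x0^{−Q·|g|_C+1} as elements of V, and for every prefix w' of w (evaluated as an element of V) one has |g·w'|_C > δ·|g|_C. -/

import Mathlib

/-!
Formalization framework for Thompson's groups `F ≤ T ≤ V` acting on the
Cantor set `{0,1}^ℕ`.  Elements of `V` are permutations of the Cantor set
admitting a finite table of branches `u → v` (complete prefix codes) with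
`g(uω) = vω`.  Products in the paper are composed left-to-right, i.e. the
paper's `g·h` is `Equiv.trans g h` (equivalently `h * g` in `Equiv.Perm`).
-/

abbrev CSeq : Type := ℕ → Bool
abbrev VPerm : Type := Equiv.Perm CSeq

/-- Concatenation of a finite binary word with an infinite binary word. -/
def app (u : List Bool) (ω : CSeq) : CSeq := fun n =>
  if h : n < u.length then u[n] else ω (n - u.length)

/-- The finite word `u` is a prefix of the infinite word `ω`. -/
def IsPref (u : List Bool) (ω : CSeq) : Prop := ∃ ω', ω = app u ω'

/-- The finite table of branches `T` represents the permutation `g` of the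
Cantor set: the domain codes and the range codes each form a complete prefix
code, and `g` maps `uω ↦ vω` for every branch `(u, v) ∈ T`. -/
def Represents (g : VPerm) (T : Finset (List Bool × List Bool)) : Prop :=
  (∀ ω : CSeq, ∃! p : List Bool × List Bool, p ∈ T ∧ IsPref p.1 ω) ∧
  (∀ ω : CSeq, ∃! p : List Bool × List Bool, p ∈ T ∧ IsPref p.2 ω) ∧
  (∀ p ∈ T, ∀ ω : CSeq, g (app p.1 ω) = app p.2 ω)

/-- A table of branches is reduced if it contains no pair of branches
`u0 → v0`, `u1 → v1`. -/
def Reduced (T : Finset (List Bool × List Bool)) : Prop :=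
  ∀ u v : List Bool,
    ¬((u ++ [false], v ++ [false]) ∈ T ∧ (u ++ [true], v ++ [true]) ∈ T)

/-- Membership in Thompson's group `V`. -/
def InV (g : VPerm) : Prop := ∃ T, Represents g T

/-- `u → v` is a branch of the (unique) reduced representation of `g`. -/
def IsBranch (g : VPerm) (u v : List Bool) : Prop :=
  ∃ T, Represents g T ∧ Reduced T ∧ (u, v) ∈ T

/-- `N(g)`: the number of branches of the reduced representation of `g`. -/
noncomputable def Nbr (g : VPerm) : ℕ :=
  sInf {n | ∃ T, Represents g T ∧ Reduced T ∧ T.card = n}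

/-- `ℓ0(g)`: the unique `ℓ ≥ 1` such that `0^ℓ` is the range code of some
branch of `g`. -/
noncomputable def ell0 (g : VPerm) : ℕ :=
  sInf {ℓ | 1 ≤ ℓ ∧ ∃ u, IsBranch g u (List.replicate ℓ false)}

/-- `ℓ1(g)`: the unique `ℓ ≥ 1` such that `1^ℓ` is the range code of some
branch of `g`. -/
noncomputable def ell1 (g : VPerm) : ℕ :=
  sInf {ℓ | 1 ≤ ℓ ∧ ∃ u, IsBranch g u (List.replicate ℓ true)}

/-- `w` is a strict prefix of the range code of some branch of `g`. -/
def StrictPrefOfBranch (g : VPerm) (w : List Bool) : Prop :=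
  ∃ u v, IsBranch g u v ∧ w <+: v ∧ w ≠ v

/-- Strict lexicographic order on infinite binary words. -/
def lexLt (a b : CSeq) : Prop :=
  ∃ n, (∀ i < n, a i = b i) ∧ a n = false ∧ b n = true

/-- Membership in Thompson's group `F`: an element of `V` preserving the
(lexicographic) order of the Cantor set. -/
def InF (g : VPerm) : Prop :=
  InV g ∧ ∀ a b : CSeq, lexLt a b → lexLt (g a) (g b)

/-- `(a, b, c)` is a (strict) cyclically ordered triple. -/
def cyc3 (a b c : CSeq) : Prop :=
  (lexLt a b ∧ lexLt b c) ∨ (lexLt b c ∧ lexLt c a) ∨ (lexLt c a ∧ lexLt a b)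

/-- Membership in Thompson's group `T`: an element of `V` preserving the
cyclic order of the Cantor set. -/
def InT (g : VPerm) : Prop :=
  InV g ∧ ∀ a b c : CSeq, cyc3 a b c → cyc3 (g a) (g b) (g c)

/-- Word length of `g` with respect to the generating set `S` (letters are
elements of `S` or inverses of elements of `S`). -/
noncomputable def wlen (S : Set VPerm) (g : VPerm) : ℕ :=
  sInf {n | ∃ l : List VPerm,
    l.length = n ∧ (∀ x ∈ l, x ∈ S ∨ x⁻¹ ∈ S) ∧ l.prod = g}

/-- `h'` is the copy `h_{[u]}` of `h` supported on the cylinder of `u`. -/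
def IsCopy (h : VPerm) (u : List Bool) (h' : VPerm) : Prop :=
  (∀ ω : CSeq, h' (app u ω) = app u (h ω)) ∧
  (∀ ω : CSeq, ¬ IsPref u ω → h' ω = ω)

/-- Evaluation (left-to-right) of the word `w` starting at the element `g`:
the paper's product `g · w`. -/
def wordEval (g : VPerm) (w : List VPerm) : VPerm :=
  w.foldl (fun a b => a.trans b) g

/-- Branches of the generator `x0`: `00→0`, `01→10`, `1→11`. -/
def x0T : Finset (List Bool × List Bool) :=
  {([false, false], [false]), ([false, true], [true, false]),
   ([true], [true, true])}

/-- Branches of the generator `x1`: `0→0`, `100→10`, `101→110`, `11→111`. -/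
def x1T : Finset (List Bool × List Bool) :=
  {([false], [false]), ([true, false, false], [true, false]),
   ([true, false, true], [true, true, false]),
   ([true, true], [true, true, true])}

/-- Branches of the generator `c1`: `0→10`, `10→11`, `11→0`. -/
def c1T : Finset (List Bool × List Bool) :=
  {([false], [true, false]), ([true, false], [true, true]),
   ([true, true], [false])}

/-- Branches of the generator `π0`: `0→10`, `10→0`, `11→11`. -/
def pi0T : Finset (List Bool × List Bool) :=
  {([false], [true, false]), ([true, false], [false]),
   ([true, true], [true, true])}

/-- The standard generators `x_j`, `j ≥ 0`, of `F`: for `r ≥ 1`,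
`x_{r+1} = x0^{-r} · x1 · x0^{r}` in the left-to-right convention of the
paper, i.e. `x0 ^ r * x1 * (x0⁻¹) ^ r` in `Equiv.Perm`. -/
def xseq (x0 x1 : VPerm) : ℕ → VPerm
  | 0 => x0
  | r + 1 => x0 ^ r * x1 * (x0⁻¹) ^ r

theorem app_nil (ω : CSeq) : app [] ω = ω := by
  funext n
  simp [app]

theorem app_append (u v : List Bool) (ω : CSeq) : app (u ++ v) ω = app u (app v ω) := by
  funext n
  unfold app
  by_cases h1 : n < u.length
  · have : n < (u ++ v).length := by simp; omega
    simp only [this, h1, dif_pos]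
    exact List.getElem_append_left h1
  · by_cases h2 : n < (u ++ v).length
    · have h3 : n - u.length < v.length := by simp at h2; omega
      simp only [h1, h2, h3, dif_pos, dif_neg, not_false_iff]
      exact List.getElem_append_right (by omega)
    · have h3 : ¬ n - u.length < v.length := by simp at h2; omega
      simp only [h1, h2, h3, dif_neg, not_false_iff]
      congr 1
      simp
      omega

theorem app_cons (a b : Bool) (l : List Bool) (ω : CSeq) :
    app (a :: b :: l) ω = app [a] (app (b :: l) ω) := app_append [a] (b :: l) ω

theorem app_cons_eq (a : Bool) (l : List Bool) (ω : CSeq) :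
    app (a :: l) ω = app [a] (app l ω) := app_append [a] l ω

theorem app_injective (u : List Bool) : Function.Injective (app u) := by
  intro ω ω' h
  funext n
  have := congrFun h (n + u.length)
  simpa [app] using this

theorem app_singleton_zero (b : Bool) (ω : CSeq) : app [b] ω 0 = b := by simp [app]

theorem app_singleton_inj {a b : Bool} {ω ω' : CSeq} :
    app [a] ω = app [b] ω' ↔ a = b ∧ ω = ω' := by
  constructor
  · intro h
    have h0 := congrFun h 0
    rw [app_singleton_zero, app_singleton_zero] at h0
    subst h0
    exact ⟨rfl, app_injective _ h⟩
  · rintro ⟨rfl, rfl⟩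
    rfl

theorem exists_eq_app_length (ω : CSeq) (n : ℕ) :
    ∃ u ω', u.length = n ∧ ω = app u ω' := by
  refine ⟨List.ofFn (fun i : Fin n => ω i), fun i => ω (i + n), by simp, ?_⟩
  funext i
  unfold app
  by_cases h : i < n
  · simp [h]
  · simp only [List.length_ofFn, h, dif_neg, not_false_iff]
    congr 1
    omega

theorem exists_eq_app_singleton (ω : CSeq) : ∃ b ω', ω = app [b] ω' := by
  obtain ⟨u, ω', hu, h⟩ := exists_eq_app_length ω 1
  obtain ⟨b, rfl⟩ := List.length_eq_one_iff.mp hu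
  exact ⟨b, ω', h⟩

/-- Of two prefixes of the same infinite word, the shorter is a prefix of the longer. -/
theorem exists_append_of_app_eq {u v : List Bool} {ω ω' : CSeq} (h : app u ω = app v ω')
    (hl : u.length ≤ v.length) : ∃ s, v = u ++ s ∧ ω = app s ω' := by
  induction u generalizing v with
  | nil => exact ⟨v, rfl, by rwa [app_nil] at h⟩
  | cons a u ih =>
    cases v with
    | nil => simp at hl
    | cons b v =>
      rw [app_cons_eq a u, app_cons_eq b v, app_singleton_inj] at h
      obtain ⟨rfl, h⟩ := h
      obtain ⟨s, rfl, hs⟩ := ih h (by simpa using hl)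
      exact ⟨s, rfl, hs⟩

/-- The constant infinite word. -/
def constSeq (e : Bool) : CSeq := fun _ => e

theorem app_replicate_constSeq (e : Bool) (m : ℕ) :
    app (List.replicate m e) (constSeq e) = constSeq e := by
  funext n
  simp [app, constSeq]

theorem perm_inv_apply (h : VPerm) (ω : CSeq) : h⁻¹ (h ω) = ω := h.symm_apply_apply ω

theorem perm_apply_inv (h : VPerm) (ω : CSeq) : h (h⁻¹ ω) = ω := h.apply_symm_apply ω

/-- The permutation `h` replaces the prefix `u` by the prefix `v`. -/
def Maps (h : VPerm) (u v : List Bool) : Prop := ∀ ω, h (app u ω) = app v ω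

namespace Maps

theorem extend {h : VPerm} {u v : List Bool} (H : Maps h u v) (s : List Bool) :
    Maps h (u ++ s) (v ++ s) := by
  intro ω
  rw [app_append, app_append, H]

theorem mul {h k : VPerm} {u v w : List Bool} (H : Maps h u v) (K : Maps k v w) :
    Maps (k * h) u w := by
  intro ω
  rw [Equiv.Perm.mul_apply, H, K]

theorem inv {h : VPerm} {u v : List Bool} (H : Maps h u v) : Maps h⁻¹ v u := by
  intro ω
  rw [← H, perm_inv_apply]

theorem one (u : List Bool) : Maps 1 u u := fun _ => rfl

end Maps

theorem app_left_injective {u v : List Bool} (h : ∀ ω, app u ω = app v ω) : u = v := by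
  wlog hl : u.length ≤ v.length generalizing u v
  · exact (this (fun ω => (h ω).symm) (by omega)).symm
  obtain ⟨s, rfl, -⟩ := exists_append_of_app_eq (h (constSeq true)) hl
  cases s with
  | nil => simp
  | cons b s =>
    have := h (constSeq (!b))
    rw [app_append] at this
    have := congrFun (app_injective _ this) 0
    rw [app_cons_eq, app_singleton_zero] at this
    cases b <;> simp [constSeq] at this

theorem Maps.unique {h : VPerm} {u v w : List Bool} (H : Maps h u v) (K : Maps h u w) : v = w :=
  app_left_injective fun ω => by rw [← H, ← K]

/-- Every point has a neighbourhood `[u]` with `u` of length at most `e` on which `h` replaces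
the prefix `u` by a prefix whose length differs from that of `u` by at most `d`. -/
def LocallyMaps (d e : ℕ) (h : VPerm) : Prop :=
  ∀ ω, ∃ u v ω', ω = app u ω' ∧ Maps h u v ∧ u.length ≤ e ∧
    v.length ≤ u.length + d ∧ u.length ≤ v.length + d

namespace LocallyMaps

theorem one : LocallyMaps 0 0 1 :=
  fun ω => ⟨[], [], ω, (app_nil ω).symm, Maps.one [], by simp, by simp, by simp⟩

theorem mono {d e d' e' : ℕ} {h : VPerm} (H : LocallyMaps d e h) (hd : d ≤ d') (he : e ≤ e') :
    LocallyMaps d' e' h := by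
  intro ω
  obtain ⟨u, v, ω', h1, h2, h3, h4, h5⟩ := H ω
  exact ⟨u, v, ω', h1, h2, by omega, by omega, by omega⟩

theorem mul {d e d' e' : ℕ} {h k : VPerm} (H : LocallyMaps d e h) (K : LocallyMaps d' e' k) :
    LocallyMaps (d' + d) (e' + e) (k * h) := by
  intro ω
  obtain ⟨u, v, ω', h1, h2, h3, h4, h5⟩ := H ω
  obtain ⟨p, q, ω'', k1, k2, k3, k4, k5⟩ := K (app v ω')
  rcases le_total p.length v.length with hl | hl
  · obtain ⟨s, rfl, -⟩ := exists_append_of_app_eq k1.symm hl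
    refine ⟨u, q ++ s, ω', h1, h2.mul (k2.extend s), by omega, ?_, ?_⟩ <;>
      simp only [List.length_append] at * <;> omega
  · obtain ⟨s, rfl, rfl⟩ := exists_append_of_app_eq k1 hl
    refine ⟨u ++ s, q, ω'', by rw [app_append, h1], (h2.extend s).mul k2, ?_, ?_, ?_⟩ <;>
      simp only [List.length_append] at * <;> omega

/-- The branch of `h` over the image of a constant word. -/
theorem exists_replicate {d e : ℕ} {h : VPerm} (H : LocallyMaps d e h) (b : Bool) :
    ∃ u m, Maps h u (List.replicate m b) ∧ 1 ≤ m ∧ u.length ≤ e + 1 ∧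
      m ≤ u.length + d ∧ u.length ≤ m + d := by
  obtain ⟨u, v, ω', h1, h2, h3, h4, h5⟩ := H (h⁻¹ (constSeq b))
  have hv : app (List.replicate v.length b) (constSeq b) = app v ω' := by
    rw [app_replicate_constSeq, ← h2, ← h1, perm_apply_inv]
  obtain ⟨s, hs, -⟩ := exists_append_of_app_eq hv (by simp)
  have hs0 : s = [] := by
    have := congrArg List.length hs
    simp only [List.length_append, List.length_replicate] at this
    exact List.eq_nil_of_length_eq_zero (by omega)
  subst hs0
  refine ⟨u ++ [b], v.length + 1, ?_, by omega, by simp; omega, by simp; omega, by simp; omega⟩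
  have := h2.extend [b]
  rw [hs, List.append_nil] at this
  rwa [List.replicate_succ']

end LocallyMaps

/-- Letters over `S`: elements of `S` and their inverses. -/
def IsLetter (S : Set VPerm) (x : VPerm) : Prop := x ∈ S ∨ x⁻¹ ∈ S

theorem IsLetter.inv {S : Set VPerm} {x : VPerm} (h : IsLetter S x) : IsLetter S x⁻¹ := by
  rcases h with h | h
  · exact Or.inr (by rwa [inv_inv])
  · exact Or.inl h

theorem IsLetter.mem_closure {S : Set VPerm} {x : VPerm} (h : IsLetter S x) :
    x ∈ Subgroup.closure S := by
  rcases h with h | h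
  · exact Subgroup.subset_closure h
  · exact inv_mem_iff.mp (Subgroup.subset_closure h)

section WordLength

variable {S : Set VPerm}

theorem wlen_le {l : List VPerm} (hl : ∀ x ∈ l, IsLetter S x) : wlen S l.prod ≤ l.length :=
  Nat.sInf_le ⟨l, rfl, hl, rfl⟩

theorem exists_word {g : VPerm} (hg : g ∈ Subgroup.closure S) :
    ∃ l : List VPerm, l.length = wlen S g ∧ (∀ x ∈ l, IsLetter S x) ∧ l.prod = g := by
  rw [← Subgroup.mem_toSubmonoid, Subgroup.closure_toSubmonoid] at hg
  obtain ⟨l, hl, hp⟩ := Submonoid.exists_list_of_mem_closure hg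
  exact Nat.sInf_mem (s := {n | ∃ l : List VPerm,
    l.length = n ∧ (∀ x ∈ l, x ∈ S ∨ x⁻¹ ∈ S) ∧ l.prod = g}) ⟨l.length, l, rfl, hl, hp⟩

theorem wlen_mul_le {g h : VPerm} (hg : g ∈ Subgroup.closure S) (hh : h ∈ Subgroup.closure S) :
    wlen S (g * h) ≤ wlen S g + wlen S h := by
  obtain ⟨l, hl, hl1, rfl⟩ := exists_word hg
  obtain ⟨k, hk, hk1, rfl⟩ := exists_word hh
  rw [← hl, ← hk, ← List.length_append, ← List.prod_append]
  apply wlen_le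
  intro x hx
  rcases List.mem_append.mp hx with hx | hx
  · exact hl1 x hx
  · exact hk1 x hx

theorem wlen_inv_le {g : VPerm} (hg : g ∈ Subgroup.closure S) : wlen S g⁻¹ ≤ wlen S g := by
  obtain ⟨l, hl, hl1, rfl⟩ := exists_word hg
  rw [← hl, List.prod_inv_reverse]
  refine (wlen_le ?_).trans (by simp)
  intro x hx
  obtain ⟨y, hy, rfl⟩ := List.mem_map.mp (List.mem_reverse.mp hx)
  exact (hl1 y hy).inv

theorem wlen_inv {g : VPerm} (hg : g ∈ Subgroup.closure S) : wlen S g⁻¹ = wlen S g :=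
  le_antisymm (wlen_inv_le hg) (by simpa using wlen_inv_le (inv_mem hg))

theorem wlen_le_mul_left {g h : VPerm} (hg : g ∈ Subgroup.closure S)
    (hh : h ∈ Subgroup.closure S) : wlen S h ≤ wlen S g + wlen S (g * h) := by
  have := wlen_mul_le (inv_mem hg) (mul_mem hg hh)
  rwa [inv_mul_cancel_left, wlen_inv hg] at this

theorem wlen_one : wlen S 1 = 0 := by
  have := wlen_le (S := S) (l := []) (by simp)
  simpa using this

theorem eq_one_of_wlen_eq_zero {g : VPerm} (hg : g ∈ Subgroup.closure S) (h : wlen S g = 0) :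
    g = 1 := by
  obtain ⟨l, hl, -, rfl⟩ := exists_word hg
  rw [h] at hl
  rw [List.eq_nil_of_length_eq_zero hl, List.prod_nil]

/-- `b` can be reached from `a` by a word of length `k`, applied after `a`, all of whose
intermediate points have length at least `n / 2`. -/
inductive AvoidingPath (S : Set VPerm) (n : ℕ) : ℕ → VPerm → VPerm → Prop
  | refl (a : VPerm) (h : n ≤ 2 * wlen S a) : AvoidingPath S n 0 a a
  | step {k : ℕ} {a b : VPerm} (x : VPerm) (p : AvoidingPath S n k a b) (hx : IsLetter S x)
      (h : n ≤ 2 * wlen S (x * b)) : AvoidingPath S n (k + 1) a (x * b)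

namespace AvoidingPath

variable {n : ℕ}

theorem le_right {k : ℕ} {a b : VPerm} (p : AvoidingPath S n k a b) : n ≤ 2 * wlen S b := by
  cases p <;> assumption

theorem trans {k l : ℕ} {a b c : VPerm} (p : AvoidingPath S n k a b)
    (q : AvoidingPath S n l b c) : AvoidingPath S n (k + l) a c := by
  induction q with
  | refl a h => exact p
  | step x q hx h ih => exact step x (ih p) hx h

theorem symm {k : ℕ} {a b : VPerm} (p : AvoidingPath S n k a b) : AvoidingPath S n k b a := by
  induction p with
  | refl a h => exact refl a h
  | @step k a b x p hx h ih =>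
    have : AvoidingPath S n 1 (x * b) b := by
      have := step x⁻¹ (refl (x * b) h) hx.inv (by simpa using p.le_right)
      simpa using this
    rw [add_comm]
    exact this.trans ih

theorem of_word {a : VPerm} (ha : a ∈ Subgroup.closure S) {l : List VPerm}
    (hl : ∀ x ∈ l, IsLetter S x) (h : n + 2 * l.length ≤ 2 * wlen S a) :
    AvoidingPath S n l.length a (l.prod * a) := by
  induction l with
  | nil => exact refl a (by simpa using h)
  | cons x l ih =>
    rw [List.prod_cons, mul_assoc]
    have hl' : ∀ y ∈ l, IsLetter S y := fun y hy => hl y (by simp [hy])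
    rw [List.length_cons] at h
    refine step x (ih hl' (by omega)) (hl x (by simp)) ?_
    have h1 := wlen_le hl
    have h2 : (x :: l).prod ∈ Subgroup.closure S :=
      list_prod_mem fun y hy => (hl y hy).mem_closure
    have h3 := wlen_le_mul_left h2 ha
    rw [List.prod_cons, mul_assoc] at h3
    rw [List.prod_cons, List.length_cons] at h1
    omega

theorem mul_left {a h : VPerm} (ha : a ∈ Subgroup.closure S) (hh : h ∈ Subgroup.closure S)
    (H : n + 2 * wlen S h ≤ 2 * wlen S a) : AvoidingPath S n (wlen S h) a (h * a) := by
  obtain ⟨l, hl, hl1, rfl⟩ := exists_word hh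
  rw [← hl] at H ⊢
  exact of_word ha hl1 H

theorem pow {a b : VPerm} (hb : IsLetter S b) (h : ∀ j, n ≤ 2 * wlen S (b ^ j * a)) (k : ℕ) :
    AvoidingPath S n k a (b ^ k * a) := by
  induction k with
  | zero => simpa using refl a (by simpa using h 0)
  | succ k ih =>
    have := step b ih hb (by simpa [pow_succ', mul_assoc] using h (k + 1))
    simpa [pow_succ', mul_assoc] using this

theorem exists_wordEval {k : ℕ} {a b : VPerm} (p : AvoidingPath S n k a b) :
    ∃ w : List VPerm, (∀ x ∈ w, IsLetter S x) ∧ w.length = k ∧ wordEval a w = b ∧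
      ∀ w', w' <+: w → n ≤ 2 * wlen S (wordEval a w') := by
  induction p with
  | refl a h =>
    refine ⟨[], by simp, rfl, rfl, fun w' hw => ?_⟩
    rw [List.prefix_nil.mp hw]
    exact h
  | @step k a b x p hx h ih =>
    obtain ⟨w, h1, h2, h3, h4⟩ := ih
    have h5 : wordEval a (w ++ [x]) = x * b := by
      rw [← h3]
      simp only [wordEval, List.foldl_append, List.foldl_cons, List.foldl_nil]
      rfl
    refine ⟨w ++ [x], ?_, by simp [h2], h5, ?_⟩
    · intro y hy
      rcases List.mem_append.mp hy with hy | hy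
      · exact h1 y hy
      · rw [List.mem_singleton.mp hy]
        exact hx
    · intro w' hw
      rcases List.prefix_concat_iff.mp hw with rfl | hw
      · rw [h5]
        exact h
      · exact h4 w' hw

end AvoidingPath

end WordLength

/-- The branches of the four generators. -/
structure GeneratorBranches (x0 x1 c1 pi0 : VPerm) : Prop where
  x0_ff : Maps x0 [false, false] [false]
  x0_ft : Maps x0 [false, true] [true, false]
  x0_t : Maps x0 [true] [true, true]
  x1_f : Maps x1 [false] [false]
  x1_tff : Maps x1 [true, false, false] [true, false]
  x1_tft : Maps x1 [true, false, true] [true, true, false]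
  x1_tt : Maps x1 [true, true] [true, true, true]
  c1_f : Maps c1 [false] [true, false]
  c1_tf : Maps c1 [true, false] [true, true]
  c1_tt : Maps c1 [true, true] [false]
  pi0_f : Maps pi0 [false] [true, false]
  pi0_tf : Maps pi0 [true, false] [false]
  pi0_tt : Maps pi0 [true, true] [true, true]

theorem generatorBranches_of_represents {x0 x1 c1 pi0 : VPerm}
    (hx0 : Represents x0 x0T) (hx1 : Represents x1 x1T)
    (hc1 : Represents c1 c1T) (hpi0 : Represents pi0 pi0T) :
    GeneratorBranches x0 x1 c1 pi0 where
  x0_ff := hx0.2.2 _ (by decide : ([false, false], [false]) ∈ x0T)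
  x0_ft := hx0.2.2 _ (by decide : ([false, true], [true, false]) ∈ x0T)
  x0_t := hx0.2.2 _ (by decide : ([true], [true, true]) ∈ x0T)
  x1_f := hx1.2.2 _ (by decide : ([false], [false]) ∈ x1T)
  x1_tff := hx1.2.2 _ (by decide : ([true, false, false], [true, false]) ∈ x1T)
  x1_tft := hx1.2.2 _ (by decide : ([true, false, true], [true, true, false]) ∈ x1T)
  x1_tt := hx1.2.2 _ (by decide : ([true, true], [true, true, true]) ∈ x1T)
  c1_f := hc1.2.2 _ (by decide : ([false], [true, false]) ∈ c1T)
  c1_tf := hc1.2.2 _ (by decide : ([true, false], [true, true]) ∈ c1T)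
  c1_tt := hc1.2.2 _ (by decide : ([true, true], [false]) ∈ c1T)
  pi0_f := hpi0.2.2 _ (by decide : ([false], [true, false]) ∈ pi0T)
  pi0_tf := hpi0.2.2 _ (by decide : ([true, false], [false]) ∈ pi0T)
  pi0_tt := hpi0.2.2 _ (by decide : ([true, true], [true, true]) ∈ pi0T)

/-- The copy of a permutation supported on the cylinder of `1`. -/
def copyTrue : VPerm →* VPerm where
  toFun h :=
    { toFun := fun ω => if ω 0 then app [true] (h fun n => ω (n + 1)) else ω
      invFun := fun ω => if ω 0 then app [true] (h⁻¹ fun n => ω (n + 1)) else ω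
      left_inv := fun ω => by
        obtain ⟨b, ω, rfl⟩ := exists_eq_app_singleton ω
        cases b <;> simp [app_singleton_zero]; simp [app]
      right_inv := fun ω => by
        obtain ⟨b, ω, rfl⟩ := exists_eq_app_singleton ω
        cases b <;> simp [app_singleton_zero]; simp [app] }
  map_one' := by
    ext1 ω
    obtain ⟨b, ω, rfl⟩ := exists_eq_app_singleton ω
    cases b <;> simp [app_singleton_zero] ; simp [app]
  map_mul' h k := by
    ext1 ω
    obtain ⟨b, ω, rfl⟩ := exists_eq_app_singleton ω
    cases b <;> simp [app_singleton_zero] ; simp [app]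

theorem copyTrue_apply_true (h : VPerm) (ω : CSeq) :
    copyTrue h (app [true] ω) = app [true] (h ω) := by
  simp [copyTrue, app_singleton_zero]
  simp [app]

theorem copyTrue_apply_false (h : VPerm) (ω : CSeq) :
    copyTrue h (app [false] ω) = app [false] ω := by
  simp [copyTrue, app_singleton_zero]

theorem Maps.copyTrue {h : VPerm} {u v : List Bool} (H : Maps h u v) :
    Maps (copyTrue h) (true :: u) (true :: v) := by
  intro ω
  rw [app_cons_eq true u, app_cons_eq true v, copyTrue_apply_true, H]

/-- The generating set. -/
abbrev generators (x0 x1 c1 pi0 : VPerm) : Set VPerm := {x0, x1, c1, pi0}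

theorem exists_eq_app_triple (ω : CSeq) :
    ∃ a b c ω', ω = app [a] (app [b] (app [c] ω')) := by
  obtain ⟨a, ω, rfl⟩ := exists_eq_app_singleton ω
  obtain ⟨b, ω, rfl⟩ := exists_eq_app_singleton ω
  obtain ⟨c, ω, rfl⟩ := exists_eq_app_singleton ω
  exact ⟨a, b, c, ω, rfl⟩

namespace GeneratorBranches

variable {x0 x1 c1 pi0 : VPerm} (G : GeneratorBranches x0 x1 c1 pi0)
include G

theorem x0_apply (ω : CSeq) :
    x0 (app [false] (app [false] ω)) = app [false] ω ∧
    x0 (app [false] (app [true] ω)) = app [true] (app [false] ω) ∧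
    x0 (app [true] ω) = app [true] (app [true] ω) := by
  simpa only [app_cons] using And.intro (G.x0_ff ω) (And.intro (G.x0_ft ω) (G.x0_t ω))

theorem x0_inv_apply (ω : CSeq) :
    x0⁻¹ (app [false] ω) = app [false] (app [false] ω) ∧
    x0⁻¹ (app [true] (app [false] ω)) = app [false] (app [true] ω) ∧
    x0⁻¹ (app [true] (app [true] ω)) = app [true] ω := by
  simpa only [app_cons] using
    And.intro (G.x0_ff.inv ω) (And.intro (G.x0_ft.inv ω) (G.x0_t.inv ω))

theorem x1_apply (ω : CSeq) :
    x1 (app [false] ω) = app [false] ω ∧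
    x1 (app [true] (app [false] (app [false] ω))) = app [true] (app [false] ω) ∧
    x1 (app [true] (app [false] (app [true] ω))) = app [true] (app [true] (app [false] ω)) ∧
    x1 (app [true] (app [true] ω)) = app [true] (app [true] (app [true] ω)) := by
  simpa only [app_cons] using And.intro (G.x1_f ω) (And.intro (G.x1_tff ω)
    (And.intro (G.x1_tft ω) (G.x1_tt ω)))

theorem x1_inv_apply (ω : CSeq) :
    x1⁻¹ (app [false] ω) = app [false] ω ∧
    x1⁻¹ (app [true] (app [false] ω)) = app [true] (app [false] (app [false] ω)) ∧
    x1⁻¹ (app [true] (app [true] (app [false] ω))) = app [true] (app [false] (app [true] ω)) ∧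
    x1⁻¹ (app [true] (app [true] (app [true] ω))) = app [true] (app [true] ω) := by
  simpa only [app_cons] using And.intro (G.x1_f.inv ω) (And.intro (G.x1_tff.inv ω)
    (And.intro (G.x1_tft.inv ω) (G.x1_tt.inv ω)))

theorem c1_apply (ω : CSeq) :
    c1 (app [false] ω) = app [true] (app [false] ω) ∧
    c1 (app [true] (app [false] ω)) = app [true] (app [true] ω) ∧
    c1 (app [true] (app [true] ω)) = app [false] ω := by
  simpa only [app_cons] using And.intro (G.c1_f ω) (And.intro (G.c1_tf ω) (G.c1_tt ω))

theorem c1_inv_apply (ω : CSeq) :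
    c1⁻¹ (app [true] (app [false] ω)) = app [false] ω ∧
    c1⁻¹ (app [true] (app [true] ω)) = app [true] (app [false] ω) ∧
    c1⁻¹ (app [false] ω) = app [true] (app [true] ω) := by
  simpa only [app_cons] using
    And.intro (G.c1_f.inv ω) (And.intro (G.c1_tf.inv ω) (G.c1_tt.inv ω))

theorem pi0_apply (ω : CSeq) :
    pi0 (app [false] ω) = app [true] (app [false] ω) ∧
    pi0 (app [true] (app [false] ω)) = app [false] ω ∧
    pi0 (app [true] (app [true] ω)) = app [true] (app [true] ω) := by
  simpa only [app_cons] using And.intro (G.pi0_f ω) (And.intro (G.pi0_tf ω) (G.pi0_tt ω))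

theorem copyTrue_x0 : copyTrue x0 = x1 := by
  ext1 ω
  obtain ⟨a, b, c, ω, rfl⟩ := exists_eq_app_triple ω
  cases a <;> cases b <;> cases c <;>
    simp only [copyTrue_apply_true, copyTrue_apply_false, G.x0_apply, G.x1_apply]

theorem copyTrue_x1 : copyTrue x1 = x0 * x1 * x0⁻¹ := by
  ext1 ω
  obtain ⟨a, b, c, ω, rfl⟩ := exists_eq_app_triple ω
  obtain ⟨d, ω, rfl⟩ := exists_eq_app_singleton ω
  cases a <;> cases b <;> cases c <;> cases d <;>
    simp only [copyTrue_apply_true, copyTrue_apply_false, Equiv.Perm.mul_apply,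
      G.x0_apply, G.x1_apply, G.x0_inv_apply]

theorem copyTrue_pi0 :
    copyTrue pi0 = (x1 * c1 * x0⁻¹) * pi0 * (x0 * c1⁻¹ * x1⁻¹) := by
  ext1 ω
  obtain ⟨a, b, c, ω, rfl⟩ := exists_eq_app_triple ω
  cases a <;> cases b <;> cases c <;>
    simp only [copyTrue_apply_true, copyTrue_apply_false, Equiv.Perm.mul_apply, G.pi0_apply,
      G.x0_apply, G.x1_apply, G.c1_apply, G.x0_inv_apply, G.x1_inv_apply, G.c1_inv_apply]

theorem copyTrue_c1 :
    copyTrue c1 = copyTrue pi0 * (x0 * (c1 * pi0 * c1⁻¹) * x0⁻¹) := by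
  ext1 ω
  obtain ⟨a, b, c, ω, rfl⟩ := exists_eq_app_triple ω
  cases a <;> cases b <;> cases c <;>
    simp only [copyTrue_apply_true, copyTrue_apply_false, Equiv.Perm.mul_apply, G.pi0_apply,
      G.x0_apply, G.c1_apply, G.x0_inv_apply, G.c1_inv_apply]

omit G in
theorem x0_mem : x0 ∈ Subgroup.closure (generators x0 x1 c1 pi0) :=
  Subgroup.subset_closure (by simp)

omit G in
theorem x1_mem : x1 ∈ Subgroup.closure (generators x0 x1 c1 pi0) :=
  Subgroup.subset_closure (by simp)

omit G in
theorem c1_mem : c1 ∈ Subgroup.closure (generators x0 x1 c1 pi0) :=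
  Subgroup.subset_closure (by simp)

omit G in
theorem pi0_mem : pi0 ∈ Subgroup.closure (generators x0 x1 c1 pi0) :=
  Subgroup.subset_closure (by simp)

theorem copyTrue_mem {h : VPerm} (hh : h ∈ Subgroup.closure (generators x0 x1 c1 pi0)) :
    copyTrue h ∈ Subgroup.closure (generators x0 x1 c1 pi0) := by
  have hpi : copyTrue pi0 ∈ Subgroup.closure (generators x0 x1 c1 pi0) := by
    rw [G.copyTrue_pi0]
    exact mul_mem (mul_mem (mul_mem (mul_mem x1_mem c1_mem) (inv_mem x0_mem)) pi0_mem)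
      (mul_mem (mul_mem x0_mem (inv_mem c1_mem)) (inv_mem x1_mem))
  have key : ∀ x ∈ generators x0 x1 c1 pi0,
      copyTrue x ∈ Subgroup.closure (generators x0 x1 c1 pi0) := by
    rintro x (h | h | h | h) <;> rw [h]
    · rw [G.copyTrue_x0]
      exact x1_mem
    · rw [G.copyTrue_x1]
      exact mul_mem (mul_mem x0_mem x1_mem) (inv_mem x0_mem)
    · rw [G.copyTrue_c1]
      exact mul_mem hpi (mul_mem (mul_mem x0_mem (mul_mem (mul_mem c1_mem pi0_mem)
        (inv_mem c1_mem))) (inv_mem x0_mem))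
    · exact hpi
  exact (Subgroup.closure_le ((Subgroup.closure (generators x0 x1 c1 pi0)).comap copyTrue)).mpr
    key hh

theorem locallyMaps_letter {x : VPerm} (hx : IsLetter (generators x0 x1 c1 pi0) x) :
    LocallyMaps 1 3 x := by
  have key : ∀ x ∈ generators x0 x1 c1 pi0, ∃ L : List (List Bool × List Bool),
      (∀ ω, ∃ p ∈ L, ∃ ω', ω = app p.1 ω') ∧ (∀ ω, ∃ p ∈ L, ∃ ω', ω = app p.2 ω') ∧
      ∀ p ∈ L, Maps x p.1 p.2 ∧ p.1.length ≤ 3 ∧ p.2.length ≤ 3 ∧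
        p.2.length ≤ p.1.length + 1 ∧ p.1.length ≤ p.2.length + 1 := by
    rintro x (rfl | rfl | rfl | rfl)
    · refine ⟨[([false, false], [false]), ([false, true], [true, false]),
        ([true], [true, true])], ?_, ?_, ?_⟩
      · intro ω
        obtain ⟨a, b, c, ω, rfl⟩ := exists_eq_app_triple ω
        cases a <;> cases b <;> simp [app_cons, app_singleton_inj]
      · intro ω
        obtain ⟨a, b, c, ω, rfl⟩ := exists_eq_app_triple ω
        cases a <;> cases b <;> simp [app_cons, app_singleton_inj]
      · simp [G.x0_ff, G.x0_ft, G.x0_t]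
    · refine ⟨[([false], [false]), ([true, false, false], [true, false]),
        ([true, false, true], [true, true, false]), ([true, true], [true, true, true])],
        ?_, ?_, ?_⟩
      · intro ω
        obtain ⟨a, b, c, ω, rfl⟩ := exists_eq_app_triple ω
        cases a <;> cases b <;> cases c <;> simp [app_cons, app_singleton_inj]
      · intro ω
        obtain ⟨a, b, c, ω, rfl⟩ := exists_eq_app_triple ω
        cases a <;> cases b <;> cases c <;> simp [app_cons, app_singleton_inj]
      · simp [G.x1_f, G.x1_tff, G.x1_tft, G.x1_tt]
    · refine ⟨[([false], [true, false]), ([true, false], [true, true]),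
        ([true, true], [false])], ?_, ?_, ?_⟩
      · intro ω
        obtain ⟨a, b, c, ω, rfl⟩ := exists_eq_app_triple ω
        cases a <;> cases b <;> simp [app_cons, app_singleton_inj]
      · intro ω
        obtain ⟨a, b, c, ω, rfl⟩ := exists_eq_app_triple ω
        cases a <;> cases b <;> simp [app_cons, app_singleton_inj]
      · simp [G.c1_f, G.c1_tf, G.c1_tt]
    · refine ⟨[([false], [true, false]), ([true, false], [false]),
        ([true, true], [true, true])], ?_, ?_, ?_⟩
      · intro ω
        obtain ⟨a, b, c, ω, rfl⟩ := exists_eq_app_triple ω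
        cases a <;> cases b <;> simp [app_cons, app_singleton_inj]
      · intro ω
        obtain ⟨a, b, c, ω, rfl⟩ := exists_eq_app_triple ω
        cases a <;> cases b <;> simp [app_cons, app_singleton_inj]
      · simp [G.pi0_f, G.pi0_tf, G.pi0_tt]
  rcases hx with hx | hx
  · obtain ⟨L, h1, -, h3⟩ := key x hx
    intro ω
    obtain ⟨p, hp, ω', h⟩ := h1 ω
    obtain ⟨k1, k2, k3, k4, k5⟩ := h3 p hp
    exact ⟨p.1, p.2, ω', h, k1, k2, k4, k5⟩
  · obtain ⟨L, -, h2, h3⟩ := key x⁻¹ hx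
    intro ω
    obtain ⟨p, hp, ω', h⟩ := h2 ω
    obtain ⟨k1, k2, k3, k4, k5⟩ := h3 p hp
    exact ⟨p.2, p.1, ω', h, by simpa using k1.inv, k3, k5, k4⟩

theorem locallyMaps_wlen {h : VPerm} (hh : h ∈ Subgroup.closure (generators x0 x1 c1 pi0)) :
    LocallyMaps (wlen (generators x0 x1 c1 pi0) h) (3 * wlen (generators x0 x1 c1 pi0) h) h := by
  obtain ⟨l, hl, hl1, rfl⟩ := exists_word hh
  rw [← hl]
  clear hl hh
  induction l with
  | nil => exact LocallyMaps.one
  | cons x l ih =>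
    rw [List.prod_cons]
    have := (ih fun y hy => hl1 y (by simp [hy])).mul (G.locallyMaps_letter (hl1 x (by simp)))
    exact this.mono (by simp; omega) (by simp; omega)

end GeneratorBranches

/-- Finite rooted binary trees, encoding complete prefix codes. -/
inductive BinTree : Type
  | leaf : BinTree
  | node : BinTree → BinTree → BinTree

namespace BinTree

/-- The addresses of the leaves. -/
def leaves : BinTree → List (List Bool)
  | leaf => [[]]
  | node l r => l.leaves.map (false :: ·) ++ r.leaves.map (true :: ·)

/-- The number of interior vertices. -/
def carets : BinTree → ℕ
  | leaf => 0
  | node l r => l.carets + r.carets + 1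

/-- A weight that decreases under right rotation. -/
def weight : BinTree → ℕ
  | leaf => 0
  | node l r => 2 * l.weight + r.weight + 1

theorem length_leaves : ∀ t : BinTree, t.leaves.length = t.carets + 1
  | leaf => rfl
  | node l r => by simp [leaves, carets, length_leaves l, length_leaves r]; omega

theorem nodup_leaves : ∀ t : BinTree, t.leaves.Nodup
  | leaf => by simp [leaves]
  | node l r => by
    rw [leaves, List.nodup_append]
    refine ⟨(nodup_leaves l).map (List.cons_injective), (nodup_leaves r).map List.cons_injective,
      ?_⟩
    intro a ha b hb
    obtain ⟨a, -, rfl⟩ := List.mem_map.mp ha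
    obtain ⟨b, -, rfl⟩ := List.mem_map.mp hb
    simp

theorem exists_leaves_of_complete (n : ℕ) (A : Set (List Bool)) (hn : ∀ a ∈ A, a.length ≤ n)
    (hA : ∀ ω, ∃! a, a ∈ A ∧ IsPref a ω) : ∃ t : BinTree, ∀ a, a ∈ t.leaves ↔ a ∈ A := by
  induction n generalizing A with
  | zero =>
    obtain ⟨a, ⟨ha, -⟩, -⟩ := hA (constSeq false)
    obtain rfl := List.eq_nil_of_length_eq_zero (Nat.le_zero.mp (hn a ha))
    refine ⟨leaf, fun b => ?_⟩
    simp only [leaves, List.mem_singleton]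
    constructor
    · rintro rfl
      exact ha
    · exact fun hb => List.eq_nil_of_length_eq_zero (Nat.le_zero.mp (hn b hb))
  | succ n ih =>
    by_cases h0 : [] ∈ A
    · refine ⟨leaf, fun b => ?_⟩
      simp only [leaves, List.mem_singleton]
      constructor
      · rintro rfl
        exact h0
      · intro hb
        exact (hA (app b (constSeq false))).unique ⟨hb, _, rfl⟩ ⟨h0, _, (app_nil _).symm⟩
    · have key : ∀ e : Bool, ∃ t : BinTree, ∀ a, a ∈ t.leaves ↔ e :: a ∈ A := by
        intro e
        refine ih {a | e :: a ∈ A} (fun a ha => ?_) fun ω => ?_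
        · have := hn _ ha
          simpa using this
        · obtain ⟨a, ⟨ha, ω', hω⟩, hu⟩ := hA (app [e] ω)
          cases a with
          | nil => exact absurd ha h0
          | cons b a =>
            rw [app_cons_eq b a, app_singleton_inj] at hω
            obtain ⟨rfl, rfl⟩ := hω
            refine ⟨a, ⟨ha, ω', rfl⟩, ?_⟩
            rintro c ⟨hc, ω'', hω⟩
            have := hu (e :: c) ⟨hc, ω'', by rw [app_cons_eq e c, hω]⟩
            exact (List.cons.inj this).2
      obtain ⟨l, hl⟩ := key false
      obtain ⟨r, hr⟩ := key true
      refine ⟨node l r, fun a => ?_⟩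
      simp only [leaves, List.mem_append, List.mem_map, hl, hr]
      cases a with
      | nil => simp [h0]
      | cons b a => cases b <;> simp

end BinTree

theorem forall₂_maps_mul {h k : VPerm} {l₁ l₂ l₃ : List (List Bool)}
    (H : List.Forall₂ (Maps h) l₁ l₂) (K : List.Forall₂ (Maps k) l₂ l₃) :
    List.Forall₂ (Maps (k * h)) l₁ l₃ := by
  induction H generalizing l₃ with
  | nil => cases K; exact List.Forall₂.nil
  | cons h1 _ ih =>
    cases K with
    | cons k1 K => exact List.Forall₂.cons (h1.mul k1) (ih K)

/-- The code `0, 10, 110, …, 1ⁿ⁻¹0, 1ⁿ`. -/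
def vine : ℕ → List (List Bool)
  | 0 => [[]]
  | n + 1 => [false] :: (vine n).map (true :: ·)

namespace GeneratorBranches

variable {x0 x1 c1 pi0 : VPerm} (G : GeneratorBranches x0 x1 c1 pi0)
include G

theorem exists_maps_vine : ∀ t : BinTree, ∃ h ∈ Subgroup.closure (generators x0 x1 c1 pi0),
    List.Forall₂ (Maps h) t.leaves (vine t.carets)
  | .leaf => ⟨1, one_mem _, by simp [BinTree.leaves, BinTree.carets, vine, Maps.one]⟩
  | .node .leaf r => by
    obtain ⟨h, hh, H⟩ := exists_maps_vine r
    refine ⟨copyTrue h, G.copyTrue_mem hh, ?_⟩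
    simp only [BinTree.leaves, BinTree.carets, vine, zero_add, List.map_cons, List.map_nil,
      List.cons_append, List.nil_append, List.forall₂_cons]
    refine ⟨copyTrue_apply_false h, ?_⟩
    rw [List.forall₂_map_left_iff, List.forall₂_map_right_iff]
    exact H.imp fun _ _ h => h.copyTrue
  | .node (.node a b) r => by
    obtain ⟨h, hh, H⟩ := exists_maps_vine (.node a (.node b r))
    refine ⟨h * x0, mul_mem hh x0_mem, ?_⟩
    have hc : (BinTree.node (.node a b) r).carets = (BinTree.node a (.node b r)).carets := by
      simp only [BinTree.carets]
      omega
    rw [hc]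
    have H0 : List.Forall₂ (Maps x0) (BinTree.node (.node a b) r).leaves
        (BinTree.node a (.node b r)).leaves := by
      simp only [BinTree.leaves, List.map_append, List.map_map, List.append_assoc]
      refine List.rel_append ?_ (List.rel_append ?_ ?_) <;>
        rw [List.forall₂_map_left_iff, List.forall₂_map_right_iff, List.forall₂_same]
      · exact fun s _ => G.x0_ff.extend s
      · exact fun s _ => G.x0_ft.extend s
      · exact fun s _ => G.x0_t.extend s
    exact forall₂_maps_mul H0 H
  termination_by t => t.weight
  decreasing_by all_goals (simp only [BinTree.weight]; omega)

theorem exists_maps_of_perm {α : Type*} {l₁ l₂ : List α} (hl : l₁.Perm l₂) :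
    ∀ n, l₁.length = n + 1 → ∃ h ∈ Subgroup.closure (generators x0 x1 c1 pi0),
      ∀ v a, (v, a) ∈ (vine n).zip l₁ → ∃ v', (v', a) ∈ (vine n).zip l₂ ∧ Maps h v v' := by
  induction hl with
  | nil => simp
  | @cons x l₁ l₂ p ih =>
    rintro (_ | n) hn
    · refine ⟨1, one_mem _, fun v a hva => ⟨v, ?_, Maps.one v⟩⟩
      simp only [List.length_cons, zero_add, Nat.add_eq_right, List.length_eq_zero_iff] at hn
      subst hn
      rwa [List.nil_perm.mp p]
    · obtain ⟨h, hh, H⟩ := ih n (by simpa using hn)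
      refine ⟨copyTrue h, G.copyTrue_mem hh, fun v a hva => ?_⟩
      simp only [vine, List.zip_cons_cons, List.mem_cons, Prod.mk.injEq, List.zip_map_left,
        List.mem_map, Prod.map, id] at hva ⊢
      rcases hva with ⟨rfl, rfl⟩ | ⟨p, hp, rfl, rfl⟩
      · exact ⟨[false], Or.inl ⟨rfl, rfl⟩, copyTrue_apply_false h⟩
      · obtain ⟨v', hv', hM⟩ := H p.1 p.2 hp
        exact ⟨true :: v', Or.inr ⟨_, hv', rfl, rfl⟩, hM.copyTrue⟩
  | swap x y l =>
    rintro (_ | _ | n) hn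
    · simp at hn
    · simp only [List.length_cons, zero_add, Nat.reduceAdd, Nat.reduceEqDiff,
        List.length_eq_zero_iff] at hn
      subst hn
      refine ⟨c1 * x0, mul_mem c1_mem x0_mem, fun v a hva => ?_⟩
      have h1 : Maps (c1 * x0) [false] [true] := by
        intro ω
        obtain ⟨b, ω, rfl⟩ := exists_eq_app_singleton ω
        cases b <;> simp only [Equiv.Perm.mul_apply, G.x0_apply, G.c1_apply]
      have h2 : Maps (c1 * x0) [true] [false] := by
        intro ω
        simp only [Equiv.Perm.mul_apply, G.x0_apply, G.c1_apply]
      simp only [vine, List.map_cons, List.map_nil, List.zip_cons_cons, List.zip_nil_right, List.mem_cons, Prod.mk.injEq, List.not_mem_nil, or_false] at hva ⊢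
      rcases hva with ⟨rfl, rfl⟩ | ⟨rfl, rfl⟩
      · exact ⟨[true], by simp, h1⟩
      · exact ⟨[false], by simp, h2⟩
    · refine ⟨pi0, pi0_mem, fun v a hva => ?_⟩
      simp only [vine, List.map_cons, List.map_map, List.zip_cons_cons, List.mem_cons,
        Prod.mk.injEq] at hva ⊢
      rcases hva with ⟨rfl, rfl⟩ | ⟨rfl, rfl⟩ | hva
      · exact ⟨[true, false], by simp, G.pi0_f⟩
      · exact ⟨[false], by simp, G.pi0_tf⟩
      · refine ⟨v, Or.inr (Or.inr hva), ?_⟩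
        obtain ⟨s, -, rfl⟩ := List.mem_map.mp (List.of_mem_zip hva).1
        exact G.pi0_tt.extend s
  | @trans l₁ l₂ l₃ p q ih1 ih2 =>
    intro n hn
    obtain ⟨h, hh, H⟩ := ih1 n hn
    obtain ⟨k, hk, K⟩ := ih2 n (by rw [← p.length_eq, hn])
    refine ⟨k * h, mul_mem hk hh, fun v a hva => ?_⟩
    obtain ⟨v', hv', hM⟩ := H v a hva
    obtain ⟨v'', hv'', hM'⟩ := K v' a hv'
    exact ⟨v'', hv'', hM.mul hM'⟩

/-- The four elements generate `V`. -/
theorem mem_closure_of_inV {g : VPerm} (hg : InV g) :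
    g ∈ Subgroup.closure (generators x0 x1 c1 pi0) := by
  classical
  obtain ⟨T, hT1, hT2, hT3⟩ := hg
  obtain ⟨n, hn⟩ : ∃ n, ∀ p ∈ T, p.1.length ≤ n ∧ p.2.length ≤ n := by
    refine ⟨T.sup fun p => p.1.length + p.2.length, fun p hp => ?_⟩
    have := Finset.le_sup (f := fun p : List Bool × List Bool => p.1.length + p.2.length) hp
    constructor <;> exact le_trans (by omega) this
  have hfun : ∀ u v v', (u, v) ∈ T → (u, v') ∈ T → v = v' := fun u v v' h h' =>
    (Prod.mk.inj ((hT1 (app u (constSeq true))).unique ⟨h, _, rfl⟩ ⟨h', _, rfl⟩)).2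
  have hinj : ∀ u u' v, (u, v) ∈ T → (u', v) ∈ T → u = u' := fun u u' v h h' =>
    (Prod.mk.inj ((hT2 (app v (constSeq true))).unique ⟨h, _, rfl⟩ ⟨h', _, rfl⟩)).1
  obtain ⟨A, hA⟩ := BinTree.exists_leaves_of_complete n {u | ∃ v, (u, v) ∈ T}
    (by rintro u ⟨v, h⟩; exact (hn _ h).1) (by
      intro ω
      obtain ⟨⟨u, v⟩, ⟨h1, h2⟩, h3⟩ := hT1 ω
      refine ⟨u, ⟨⟨v, h1⟩, h2⟩, ?_⟩
      rintro u' ⟨⟨v', h'⟩, hp⟩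
      exact (Prod.mk.inj (h3 (u', v') ⟨h', hp⟩)).1)
  obtain ⟨B, hB⟩ := BinTree.exists_leaves_of_complete n {v | ∃ u, (u, v) ∈ T}
    (by rintro v ⟨u, h⟩; exact (hn _ h).2) (by
      intro ω
      obtain ⟨⟨u, v⟩, ⟨h1, h2⟩, h3⟩ := hT2 ω
      refine ⟨v, ⟨⟨u, h1⟩, h2⟩, ?_⟩
      rintro v' ⟨⟨u', h'⟩, hp⟩
      exact (Prod.mk.inj (h3 (u', v') ⟨h', hp⟩)).2)
  replace hA : ∀ u, u ∈ A.leaves ↔ ∃ v, (u, v) ∈ T := hA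
  replace hB : ∀ v, v ∈ B.leaves ↔ ∃ u, (u, v) ∈ T := hB
  have hf : ∀ u, ∃ v, u ∈ A.leaves → (u, v) ∈ T := fun u => by
    by_cases h : u ∈ A.leaves
    · exact ((hA u).mp h).imp fun _ hv _ => hv
    · exact ⟨[], fun h' => absurd h' h⟩
  choose f hf using hf
  have hperm : (A.leaves.map f).Perm B.leaves := by
    refine (List.perm_ext_iff_of_nodup ?_ B.nodup_leaves).mpr fun v => ?_
    · refine List.Nodup.map_on (fun u hu u' hu' h => ?_) A.nodup_leaves
      exact hinj u u' (f u) (hf u hu) (h ▸ hf u' hu')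
    · rw [hB, List.mem_map]
      constructor
      · rintro ⟨u, hu, rfl⟩
        exact ⟨u, hf u hu⟩
      · rintro ⟨u, hu⟩
        have hu' := (hA u).mpr ⟨v, hu⟩
        exact ⟨u, hu', hfun _ _ _ (hf u hu') hu⟩
  have hcard : A.carets = B.carets := by
    have := hperm.length_eq
    rw [List.length_map, A.length_leaves, B.length_leaves] at this
    omega
  obtain ⟨hA', hA'mem, HA⟩ := G.exists_maps_vine A
  obtain ⟨hB', hB'mem, HB⟩ := G.exists_maps_vine B
  obtain ⟨k, hk, K⟩ := G.exists_maps_of_perm hperm A.carets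
    (by rw [List.length_map, A.length_leaves])
  have hgk : g = hB'⁻¹ * (k * hA') := by
    ext1 ω
    obtain ⟨⟨u, v⟩, ⟨huv, ω', rfl⟩, -⟩ := hT1 ω
    have hu := (hA u).mpr ⟨v, huv⟩
    have hfu : f u = v := hfun _ _ _ (hf u hu) huv
    obtain ⟨i, hi, rfl⟩ := List.mem_iff_getElem.mp hu
    have hi' : i < (vine A.carets).length := by rwa [← HA.length_eq]
    have M1 : Maps hA' A.leaves[i] (vine A.carets)[i] := List.Forall₂.get HA hi hi'
    obtain ⟨v', hv', M2⟩ := K (vine A.carets)[i] v (by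
      refine List.mem_iff_getElem.mpr ⟨i, by simpa using ⟨hi', hi⟩, ?_⟩
      simp [hfu])
    rw [hcard] at hv'
    obtain ⟨j, hj, hj'⟩ := List.mem_iff_getElem.mp hv'
    rw [List.getElem_zip, Prod.mk.injEq] at hj'
    rw [List.length_zip, lt_min_iff] at hj
    have M3 : Maps hB' B.leaves[j] (vine B.carets)[j] := List.Forall₂.get HB hj.2 hj.1
    rw [hj'.1, hj'.2] at M3
    rw [hT3 _ huv, ((M1.mul M2).mul M3.inv)]
  rw [hgk]
  exact mul_mem (inv_mem hB'mem) (mul_mem hk hA'mem)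

end GeneratorBranches

theorem LocallyMaps.length_le {d e : ℕ} {h : VPerm} (H : LocallyMaps d e h) {u v : List Bool}
    (hM : Maps h u v) : v.length ≤ u.length + d ∧ u.length ≤ v.length + d := by
  obtain ⟨p, q, ω', h1, h2, -, h4, h5⟩ := H (app u (constSeq true))
  rcases le_total p.length u.length with hl | hl
  · obtain ⟨s, rfl, -⟩ := exists_append_of_app_eq h1.symm hl
    obtain rfl := hM.unique (h2.extend s)
    simp only [List.length_append]
    omega
  · obtain ⟨s, rfl, -⟩ := exists_append_of_app_eq h1 hl
    obtain rfl := h2.unique (hM.extend s)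
    simp only [List.length_append] at h4 h5
    omega

/-- If `h` scales two parts of the cylinder of `a` differently, then `a` is short. -/
theorem LocallyMaps.length_le_of_ne {d e : ℕ} {h : VPerm} (H : LocallyMaps d e h)
    {a s₁ s₂ v₁ v₂ : List Bool} (h₁ : Maps h (a ++ s₁) v₁) (h₂ : Maps h (a ++ s₂) v₂)
    (hne : v₁.length + s₂.length ≠ v₂.length + s₁.length) : a.length ≤ e := by
  by_contra! hlt
  obtain ⟨p, q, ω', k1, k2, k3, -, -⟩ := H (app a (constSeq true))
  obtain ⟨s, rfl, -⟩ := exists_append_of_app_eq k1.symm (by omega)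
  rw [List.append_assoc] at h₁ h₂
  obtain rfl := h₁.unique (k2.extend _)
  obtain rfl := h₂.unique (k2.extend _)
  simp only [List.length_append] at hne
  omega

theorem exists_eq_app_replicate (e : Bool) (k : ℕ) (ω : CSeq) :
    (∃ ω', ω = app (List.replicate (k + 1) e) ω') ∨
      ∃ i ≤ k, ∃ ω', ω = app (List.replicate i e ++ [!e]) ω' := by
  induction k generalizing ω with
  | zero =>
    obtain ⟨b, ω, rfl⟩ := exists_eq_app_singleton ω
    by_cases hb : b = e
    · subst hb
      exact Or.inl ⟨ω, rfl⟩
    · obtain rfl : b = !e := by cases b <;> cases e <;> simp_all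
      exact Or.inr ⟨0, le_rfl, ω, rfl⟩
  | succ k ih =>
    obtain ⟨b, ω, rfl⟩ := exists_eq_app_singleton ω
    by_cases hb : b = e
    · subst hb
      rcases ih ω with ⟨ω', rfl⟩ | ⟨i, hi, ω', rfl⟩
      · exact Or.inl ⟨ω', (app_cons_eq b (List.replicate (k + 1) b) ω').symm⟩
      · exact Or.inr ⟨i + 1, by omega, ω', (app_cons_eq b (List.replicate i b ++ [!b]) ω').symm⟩
    · obtain rfl : b = !e := by cases b <;> cases e <;> simp_all
      exact Or.inr ⟨0, by omega, ω, rfl⟩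

/-- The power of `x0` that shortens the words starting with `ee`. -/
def contraction (x0 : VPerm) (e : Bool) : VPerm := if e then x0⁻¹ else x0

/-- A word for the copy of `x0` at the cylinder of `e`. -/
def seedWord (x0 x1 : VPerm) (e : Bool) : List VPerm :=
  if e then [x1] else [x0⁻¹, x1⁻¹, x0, x0]

/-- The copy of `x0` at the cylinder of `eᵏ⁺¹`. -/
def deepCopy (x0 x1 : VPerm) (e : Bool) (k : ℕ) : VPerm :=
  (contraction x0 e ^ k)⁻¹ * (seedWord x0 x1 e).prod * contraction x0 e ^ k

namespace GeneratorBranches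

variable {x0 x1 c1 pi0 : VPerm} (G : GeneratorBranches x0 x1 c1 pi0)

theorem isLetter_contraction (e : Bool) :
    IsLetter (generators x0 x1 c1 pi0) (contraction x0 e) := by
  cases e
  · exact Or.inl (by simp [contraction])
  · exact Or.inr (by simp [contraction])

theorem isLetter_of_mem_seedWord (e : Bool) :
    ∀ x ∈ seedWord x0 x1 e, IsLetter (generators x0 x1 c1 pi0) x := by
  cases e <;> simp [seedWord, IsLetter]

theorem length_seedWord_le (e : Bool) : (seedWord x0 x1 e).length ≤ 4 := by
  cases e <;> simp [seedWord]

theorem deepCopy_mem (e : Bool) (k : ℕ) :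
    deepCopy x0 x1 e k ∈ Subgroup.closure (generators x0 x1 c1 pi0) :=
  mul_mem (mul_mem (inv_mem (pow_mem (isLetter_contraction e).mem_closure k))
    (list_prod_mem fun x hx => (isLetter_of_mem_seedWord e x hx).mem_closure))
    (pow_mem (isLetter_contraction e).mem_closure k)

include G

theorem maps_contraction (e : Bool) : Maps (contraction x0 e) [e, e] [e] ∧
    Maps (contraction x0 e) [e, !e] [!e, e] ∧ Maps (contraction x0 e) [!e] [!e, !e] := by
  cases e
  · exact ⟨G.x0_ff, G.x0_ft, G.x0_t⟩
  · exact ⟨G.x0_t.inv, G.x0_ft.inv, G.x0_ff.inv⟩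

theorem maps_contraction_pow (e : Bool) (k m : ℕ) : Maps (contraction x0 e ^ k)
    (List.replicate (m + 1 + k) e) (List.replicate (m + 1) e) := by
  induction k with
  | zero => exact Maps.one _
  | succ k ih =>
    rw [pow_succ]
    refine Maps.mul ?_ ih
    have := (G.maps_contraction e).1.extend (List.replicate (m + k) e)
    convert this using 1
    · rw [show m + 1 + (k + 1) = m + k + 1 + 1 by omega]
      rfl
    · rw [show m + 1 + k = m + k + 1 by omega]
      rfl

theorem exists_maps_contraction_pow (e : Bool) (k i : ℕ) (hi : i ≤ k) :
    ∃ w, Maps (contraction x0 e ^ k) (List.replicate i e ++ [!e]) ((!e) :: w) := by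
  induction k generalizing i with
  | zero =>
    obtain rfl : i = 0 := by omega
    exact ⟨[], Maps.one _⟩
  | succ k ih =>
    obtain ⟨h1, h2, h3⟩ := G.maps_contraction e
    rw [pow_succ]
    rcases i with _ | _ | i
    · obtain ⟨w, hw⟩ := ih 0 (by omega)
      exact ⟨_, h3.mul (hw.extend [!e])⟩
    · obtain ⟨w, hw⟩ := ih 0 (by omega)
      exact ⟨_, h2.mul (hw.extend [e])⟩
    · obtain ⟨w, hw⟩ := ih (i + 1) (by omega)
      exact ⟨w, (h1.extend (List.replicate i e ++ [!e])).mul hw⟩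

theorem maps_seedWord (e : Bool) : Maps (seedWord x0 x1 e).prod [!e] [!e] ∧
    Maps (seedWord x0 x1 e).prod [e, false, false] [e, false] ∧
    Maps (seedWord x0 x1 e).prod [e, false, true] [e, true, false] ∧
    Maps (seedWord x0 x1 e).prod [e, true] [e, true, true] := by
  cases e
  · refine ⟨?_, ?_, ?_, ?_⟩ <;> simp only [seedWord, Bool.false_eq_true, if_false, List.prod_cons,
      List.prod_nil, mul_one, Bool.not_false]
    · exact ((G.x0_t.mul (G.x0_t.extend [true])).mul G.x1_tt.inv).mul G.x0_t.inv
    · exact (((G.x0_ff.extend [false]).mul G.x0_ff).mul G.x1_f.inv).mul G.x0_ff.inv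
    · exact (((G.x0_ff.extend [true]).mul G.x0_ft).mul G.x1_tff.inv).mul
        (G.x0_ft.inv.extend [false])
    · exact ((G.x0_ft.mul (G.x0_t.extend [false])).mul G.x1_tft.inv).mul
        (G.x0_ft.inv.extend [true])
  · refine ⟨?_, ?_, ?_, ?_⟩ <;> simp [seedWord, G.x1_f, G.x1_tff, G.x1_tft, G.x1_tt]

theorem maps_deepCopy_of_maps_seedWord {e : Bool} {p q : List Bool}
    (h : Maps (seedWord x0 x1 e).prod (e :: p) (e :: q)) (k : ℕ) :
    Maps (deepCopy x0 x1 e k) (List.replicate (k + 1) e ++ p)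
      (List.replicate (k + 1) e ++ q) := by
  have H := G.maps_contraction_pow e k 0
  rw [zero_add, add_comm] at H
  have := ((H.extend p).mul h).mul (H.extend q).inv
  rwa [← mul_assoc] at this

theorem maps_deepCopy (e : Bool) (k : ℕ) :
    Maps (deepCopy x0 x1 e k) (List.replicate (k + 1) e ++ [false, false])
      (List.replicate (k + 1) e ++ [false]) ∧
    Maps (deepCopy x0 x1 e k) (List.replicate (k + 1) e ++ [false, true])
      (List.replicate (k + 1) e ++ [true, false]) ∧
    Maps (deepCopy x0 x1 e k) (List.replicate (k + 1) e ++ [true])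
      (List.replicate (k + 1) e ++ [true, true]) :=
  ⟨G.maps_deepCopy_of_maps_seedWord (G.maps_seedWord e).2.1 k,
    G.maps_deepCopy_of_maps_seedWord (G.maps_seedWord e).2.2.1 k,
    G.maps_deepCopy_of_maps_seedWord (G.maps_seedWord e).2.2.2 k⟩

theorem maps_deepCopy_self (e : Bool) {k i : ℕ} (hi : i ≤ k) :
    Maps (deepCopy x0 x1 e k) (List.replicate i e ++ [!e]) (List.replicate i e ++ [!e]) := by
  obtain ⟨w, hw⟩ := G.exists_maps_contraction_pow e k i hi
  have := (hw.mul ((G.maps_seedWord e).1.extend w)).mul hw.inv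
  rwa [← mul_assoc] at this

theorem locallyMaps_deepCopy (e : Bool) (k : ℕ) :
    LocallyMaps 1 (k + 3) (deepCopy x0 x1 e k) := by
  intro ω
  rcases exists_eq_app_replicate e k ω with ⟨ω, rfl⟩ | ⟨i, hi, ω, rfl⟩
  · obtain ⟨h1, h2, h3⟩ := G.maps_deepCopy e k
    obtain ⟨a, ω, rfl⟩ := exists_eq_app_singleton ω
    cases a
    · obtain ⟨b, ω, rfl⟩ := exists_eq_app_singleton ω
      rw [← app_append, ← app_append]
      cases b
      · exact ⟨_, _, ω, by rw [List.append_assoc]; rfl, h1, by simp, by simp, by simp⟩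
      · exact ⟨_, _, ω, by rw [List.append_assoc]; rfl, h2, by simp, by simp, by simp⟩
    · exact ⟨_, _, ω, (app_append _ _ _).symm, h3, by simp, by simp, by simp⟩
  · exact ⟨_, _, ω, rfl, G.maps_deepCopy_self e hi, by simp; omega, by simp, by simp⟩

theorem maps_deepCopy_append_replicate (e : Bool) {k c : ℕ} (u : List Bool)
    (hu : u.length ≤ k) :
    Maps (deepCopy x0 x1 (!e) k) (u ++ List.replicate (c + 1) e)
      (u ++ List.replicate (c + 1) e) := by
  have key : ∀ u : List Bool, ∃ i ≤ u.length, ∃ r,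
      u ++ List.replicate (c + 1) e = List.replicate i (!e) ++ [!!e] ++ r := by
    intro u
    induction u with
    | nil => exact ⟨0, le_rfl, List.replicate c e, by simp [List.replicate_succ]⟩
    | cons b u ih =>
      by_cases hb : b = e
      · exact ⟨0, by simp, u ++ List.replicate (c + 1) e, by simp [hb]⟩
      · obtain ⟨i, hi, r, h⟩ := ih
        obtain rfl : b = !e := by cases b <;> cases e <;> simp_all
        exact ⟨i + 1, by simpa using hi, r, by
          rw [List.cons_append, h, List.replicate_succ]; simp⟩
  obtain ⟨i, hi, r, h⟩ := key u
  rw [h]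
  exact (G.maps_deepCopy_self (!e) (by omega)).extend r

omit G

local notation "ℓ" => wlen (generators x0 x1 c1 pi0)

theorem wlen_contraction_pow_le (e : Bool) (j : ℕ) : ℓ (contraction x0 e ^ j) ≤ j := by
  have := wlen_le (S := generators x0 x1 c1 pi0) (l := List.replicate j (contraction x0 e))
    (fun x hx => by
      rw [List.eq_of_mem_replicate hx]
      exact isLetter_contraction e)
  simpa using this

theorem le_two_mul_wlen_contraction_pow_mul {a : VPerm}
    (ha : a ∈ Subgroup.closure (generators x0 x1 c1 pi0)) {e : Bool} {n d : ℕ}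
    (h : ∀ j, j ≤ d + ℓ (contraction x0 e ^ j * a)) (hn : n + d ≤ ℓ a) (j : ℕ) :
    n ≤ 2 * ℓ (contraction x0 e ^ j * a) := by
  have h1 := wlen_contraction_pow_le (x0 := x0) (x1 := x1) (c1 := c1) (pi0 := pi0) e j
  have h2 := wlen_le_mul_left (pow_mem (isLetter_contraction (x0 := x0) (x1 := x1) (c1 := c1)
    (pi0 := pi0) e).mem_closure j) ha
  have h3 := h j
  omega

theorem avoidingPath_deepCopy {a : VPerm}
    (ha : a ∈ Subgroup.closure (generators x0 x1 c1 pi0)) {e : Bool} {n d d' k : ℕ}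
    (h : ∀ j, j ≤ d + ℓ (contraction x0 e ^ j * a)) (hn : n + d ≤ ℓ a)
    (h' : ∀ j, j ≤ d' + ℓ (contraction x0 e ^ j * (deepCopy x0 x1 e k * a)))
    (hn' : n + d' ≤ ℓ (deepCopy x0 x1 e k * a)) (hk : n + 8 + 2 * d ≤ 2 * k) :
    AvoidingPath (generators x0 x1 c1 pi0) n (k + (seedWord x0 x1 e).length + k) a
      (deepCopy x0 x1 e k * a) := by
  have hb := isLetter_contraction (x0 := x0) (x1 := x1) (c1 := c1) (pi0 := pi0) e
  have p1 := AvoidingPath.pow hb (le_two_mul_wlen_contraction_pow_mul ha h hn) k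
  have p3 := AvoidingPath.pow hb
    (le_two_mul_wlen_contraction_pow_mul (mul_mem (deepCopy_mem e k) ha) h' hn') k
  have p2 := AvoidingPath.of_word (n := n) (mul_mem (pow_mem hb.mem_closure k) ha)
    (isLetter_of_mem_seedWord (x1 := x1) e) (by
      have h1 := h k
      have h2 := length_seedWord_le (x0 := x0) (x1 := x1) e
      omega)
  have heq : contraction x0 e ^ k * (deepCopy x0 x1 e k * a) =
      (seedWord x0 x1 e).prod * (contraction x0 e ^ k * a) := by
    rw [deepCopy]
    group
  rw [heq] at p3
  exact (p1.trans p2).trans p3.symm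

include G

theorem le_add_wlen_contraction_pow_mul {a : VPerm}
    (ha : a ∈ Subgroup.closure (generators x0 x1 c1 pi0)) {d E : ℕ} (H : LocallyMaps d E a)
    (e : Bool) (j : ℕ) : j ≤ d + ℓ (contraction x0 e ^ j * a) := by
  obtain ⟨u, m, h1, h2, -, h4, h5⟩ := H.exists_replicate e
  obtain ⟨m, rfl⟩ : ∃ i, m = i + 1 := ⟨m - 1, by omega⟩
  have h6 := h1.extend (List.replicate j e)
  rw [List.replicate_append_replicate] at h6
  have h7 := (G.locallyMaps_wlen (mul_mem (pow_mem (isLetter_contraction e).mem_closure j)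
    ha)).length_le (h6.mul (G.maps_contraction_pow e j m))
  simp only [List.length_append, List.length_replicate] at h7
  omega

/-- One of the two rays from `a` never gets closer to the identity than its time parameter. -/
theorem exists_le_wlen_contraction_pow_mul {a : VPerm}
    (ha : a ∈ Subgroup.closure (generators x0 x1 c1 pi0)) :
    ∃ e, ∀ j, j ≤ ℓ (contraction x0 e ^ j * a) := by
  obtain ⟨u, m, h1, h2, -⟩ := (G.locallyMaps_wlen ha).exists_replicate false
  obtain ⟨m, rfl⟩ : ∃ i, m = i + 1 := ⟨m - 1, by omega⟩
  have hb : ∀ e j, contraction x0 e ^ j * a ∈ Subgroup.closure (generators x0 x1 c1 pi0) :=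
    fun e j => mul_mem (pow_mem (isLetter_contraction e).mem_closure j) ha
  rcases le_total (m + 1) u.length with hm | hm
  · refine ⟨false, fun j => ?_⟩
    have h6 := h1.extend (List.replicate j false)
    rw [List.replicate_append_replicate] at h6
    have h7 := (G.locallyMaps_wlen (hb false j)).length_le
      (h6.mul (G.maps_contraction_pow false j m))
    simp only [List.length_append, List.length_replicate] at h7
    omega
  · refine ⟨true, fun j => ?_⟩
    have h6 := (G.maps_contraction_pow false j m).inv
    have h7 : (contraction x0 false ^ j)⁻¹ = contraction x0 true ^ j := by
      simp [contraction]
    rw [h7] at h6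
    have h8 := (G.locallyMaps_wlen (hb true j)).length_le (h1.mul h6)
    simp only [List.length_replicate] at h8
    omega

theorem le_wlen_deepCopy (e : Bool) (k : ℕ) : k + 1 ≤ 3 * ℓ (deepCopy x0 x1 e k) := by
  have := (G.locallyMaps_wlen (deepCopy_mem e k)).length_le_of_ne (G.maps_deepCopy e k).1
    (G.maps_deepCopy e k).2.2 (by simp)
  simpa using this

/-- Conjugates of the deep copy at `eᵏ⁺¹` by short elements are long, and they commute with the
deep copy on the opposite side. -/
theorem conj_deepCopy {g : VPerm} (hg : g ∈ Subgroup.closure (generators x0 x1 c1 pi0))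
    (e : Bool) {n k : ℕ} (hn : ℓ g ≤ n) (hk : 16 * n + 20 ≤ k) :
    5 * n + 7 ≤ ℓ (g⁻¹ * deepCopy x0 x1 e k * g) ∧
    5 * n + 7 ≤ ℓ (deepCopy x0 x1 (!e) k * (g⁻¹ * deepCopy x0 x1 e k * g)) ∧
    Commute (deepCopy x0 x1 (!e) k) (g⁻¹ * deepCopy x0 x1 e k * g) := by
  obtain ⟨u, m, h1, h2, h3, h4, h5⟩ := (G.locallyMaps_wlen hg).exists_replicate e
  obtain ⟨c, hc⟩ : ∃ c, m + (c + 1) = k + 1 := ⟨k - m, by omega⟩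
  have hga : Maps g (u ++ List.replicate (c + 1) e) (List.replicate (k + 1) e) := by
    have := h1.extend (List.replicate (c + 1) e)
    rwa [List.replicate_append_replicate, hc] at this
  have hz := G.maps_deepCopy_append_replicate e (k := k) (c := c) u (by omega)
  have hlen : (u ++ List.replicate (c + 1) e).length = u.length + (c + 1) := by simp
  generalize u ++ List.replicate (c + 1) e = a at hga hz hlen
  have hconj : ∀ p q, Maps (deepCopy x0 x1 e k) (List.replicate (k + 1) e ++ p)
      (List.replicate (k + 1) e ++ q) →
      Maps (g⁻¹ * deepCopy x0 x1 e k * g) (a ++ p) (a ++ q) := by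
    intro p q h
    have := ((hga.extend p).mul h).mul (hga.extend q).inv
    rwa [← mul_assoc] at this
  have m1 := hconj _ _ (G.maps_deepCopy e k).1
  have m2 := hconj _ _ (G.maps_deepCopy e k).2.2
  have hs : g⁻¹ * deepCopy x0 x1 e k * g ∈ Subgroup.closure (generators x0 x1 c1 pi0) :=
    mul_mem (mul_mem (inv_mem hg) (deepCopy_mem e k)) hg
  have l1 := (G.locallyMaps_wlen hs).length_le_of_ne m1 m2 (by simp)
  have l2 := (G.locallyMaps_wlen (mul_mem (deepCopy_mem (!e) k) hs)).length_le_of_ne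
    (m1.mul (hz.extend _)) (m2.mul (hz.extend _)) (by simp)
  refine ⟨by omega, by omega, Equiv.Perm.Disjoint.commute fun ω => ?_⟩
  rcases exists_eq_app_replicate e k (g ω) with ⟨ω', h⟩ | ⟨i, hi, ω', h⟩
  · left
    rw [← hga ω'] at h
    rw [g.injective h, hz]
  · right
    rw [Equiv.Perm.mul_apply, Equiv.Perm.mul_apply, h, G.maps_deepCopy_self e hi, ← h,
      perm_inv_apply]

theorem avoidingPath_conj_deepCopy {g : VPerm}
    (hg : g ∈ Subgroup.closure (generators x0 x1 c1 pi0)) (e : Bool) {n k : ℕ} (hn : ℓ g ≤ n)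
    (hk : 16 * n + 20 ≤ k) :
    ∃ L ≤ 4 * k + 2 * n + 8, AvoidingPath (generators x0 x1 c1 pi0) n L
      (g⁻¹ * deepCopy x0 x1 e k * g) (deepCopy x0 x1 (!e) k) := by
  obtain ⟨b1, b2, hcomm⟩ := G.conj_deepCopy hg e hn hk
  have hs := deepCopy_mem (x0 := x0) (x1 := x1) (c1 := c1) (pi0 := pi0) e k
  have hz := deepCopy_mem (x0 := x0) (x1 := x1) (c1 := c1) (pi0 := pi0) (!e) k
  have hsc : g⁻¹ * deepCopy x0 x1 e k * g ∈ Subgroup.closure (generators x0 x1 c1 pi0) :=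
    mul_mem (mul_mem (inv_mem hg) hs) hg
  have b3 := G.le_wlen_deepCopy (!e) k
  have loc := G.locallyMaps_wlen hg
  have locinv := G.locallyMaps_wlen (inv_mem hg)
  rw [wlen_inv hg] at locinv
  have lsc := (loc.mul (G.locallyMaps_deepCopy e k)).mul locinv
  rw [← mul_assoc] at lsc
  have p1 := avoidingPath_deepCopy (n := n) (k := k) hsc
    (G.le_add_wlen_contraction_pow_mul hsc lsc (!e)) (by omega)
    (G.le_add_wlen_contraction_pow_mul (mul_mem hz hsc)
      (lsc.mul (G.locallyMaps_deepCopy (!e) k)) (!e)) (by omega) (by omega)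
  have b4 : ℓ (deepCopy x0 x1 (!e) k) ≤ ℓ g + ℓ (g * deepCopy x0 x1 (!e) k) :=
    wlen_le_mul_left hg hz
  have heq : g⁻¹ * (deepCopy x0 x1 e k * (g * deepCopy x0 x1 (!e) k)) =
      deepCopy x0 x1 (!e) k * (g⁻¹ * deepCopy x0 x1 e k * g) := by
    rw [hcomm.eq]
    group
  have hsgz := mul_mem hs (mul_mem hg hz)
  have b5 := wlen_mul_le (inv_mem hg) hsgz
  rw [heq, wlen_inv hg] at b5
  have q1 := AvoidingPath.mul_left (n := n) hz hg (by omega)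
  have lgz := (G.locallyMaps_deepCopy (!e) k).mul loc
  have q2 := avoidingPath_deepCopy (e := e) (n := n) (k := k) (mul_mem hg hz)
    (G.le_add_wlen_contraction_pow_mul (mul_mem hg hz) lgz e) (by omega)
    (G.le_add_wlen_contraction_pow_mul hsgz
      (lgz.mul (G.locallyMaps_deepCopy e k)) e) (by omega) (by omega)
  have q3 := AvoidingPath.mul_left (n := n) hsgz (inv_mem hg) (by
    rw [wlen_inv hg]
    omega)
  rw [heq, wlen_inv hg] at q3
  refine ⟨_, ?_, p1.trans ((q1.trans q2).trans q3).symm⟩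
  have := length_seedWord_le (x0 := x0) (x1 := x1) e
  have := length_seedWord_le (x0 := x0) (x1 := x1) (!e)
  omega

theorem exists_avoidingPath {g : VPerm}
    (hg : g ∈ Subgroup.closure (generators x0 x1 c1 pi0)) {k : ℕ} (hk : 16 * ℓ g + 20 ≤ k) :
    ∃ L ≤ 10 * k + 5 * ℓ g + 20, AvoidingPath (generators x0 x1 c1 pi0) (ℓ g) L g
      (deepCopy x0 x1 false k) := by
  obtain ⟨e, he⟩ := G.exists_le_wlen_contraction_pow_mul hg
  obtain ⟨b1, -, -⟩ := G.conj_deepCopy hg e le_rfl hk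
  have hs := deepCopy_mem (x0 := x0) (x1 := x1) (c1 := c1) (pi0 := pi0) e k
  have hsg := mul_mem hs hg
  have b2 := wlen_mul_le (inv_mem hg) hsg
  rw [← mul_assoc, wlen_inv hg] at b2
  have p1 := avoidingPath_deepCopy (d := 0) (n := ℓ g) (k := k) hg (by simpa using he) le_rfl
    (G.le_add_wlen_contraction_pow_mul hsg
      ((G.locallyMaps_wlen hg).mul (G.locallyMaps_deepCopy e k)) e) (by omega) (by omega)
  have p2 := AvoidingPath.mul_left (n := ℓ g) hsg (inv_mem hg) (by
    rw [wlen_inv hg]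
    omega)
  rw [← mul_assoc, wlen_inv hg] at p2
  have hL := length_seedWord_le (x0 := x0) (x1 := x1) e
  obtain ⟨L, hLk, p3⟩ := G.avoidingPath_conj_deepCopy hg e le_rfl hk
  cases e with
  | true => exact ⟨_, by omega, (p1.trans p2).trans p3⟩
  | false =>
    obtain ⟨M, hMk, p4⟩ := G.avoidingPath_conj_deepCopy (one_mem _) true (n := ℓ g)
      (by rw [wlen_one]; omega) hk
    simp only [inv_one, one_mul, mul_one] at p4
    exact ⟨_, by omega, ((p1.trans p2).trans p3).trans p4⟩

end GeneratorBranches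

theorem nbr_one_le : Nbr 1 ≤ 1 := by
  refine Nat.sInf_le ⟨{([], [])}, ⟨fun ω => ?_, fun ω => ?_, ?_⟩, ?_, rfl⟩
  · exact ⟨([], []), ⟨by simp, ω, (app_nil ω).symm⟩, by simp⟩
  · exact ⟨([], []), ⟨by simp, ω, (app_nil ω).symm⟩, by simp⟩
  · simp
  · intro u v
    simp

/-- There exist `δ, D > 0` and a positive integer `Q` such
that for every `g ∈ V` with `N(g) ≥ 4` there is a word `w` in the letters
`x0^{±1}, x1^{±1}, c1^{±1}, π0^{±1}` of length at most `D·|g|_C`, with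
`g·w = x0^{Q|g|_C}·x1^{−1}·x0^{−Q|g|_C+1}` (left-to-right products), and
`|g·w'|_C > δ·|g|_C` for every prefix `w'` of `w`. -/
theorem stmt16 (x0 x1 c1 pi0 : VPerm)
    (hx0 : Represents x0 x0T) (hx1 : Represents x1 x1T)
    (hc1 : Represents c1 c1T) (hpi0 : Represents pi0 pi0T) :
    ∃ δ D : ℝ, ∃ Q : ℕ, 0 < δ ∧ 0 < D ∧ 0 < Q ∧
      ∀ g : VPerm, InV g → 4 ≤ Nbr g →
        ∃ w : List VPerm,
          (∀ x ∈ w, x = x0 ∨ x = x0⁻¹ ∨ x = x1 ∨ x = x1⁻¹ ∨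
            x = c1 ∨ x = c1⁻¹ ∨ x = pi0 ∨ x = pi0⁻¹) ∧
          (w.length : ℝ) ≤ D * (wlen {x0, x1, c1, pi0} g : ℝ) ∧
          wordEval g w =
            x0 ^ (1 - ((Q * wlen {x0, x1, c1, pi0} g : ℕ) : ℤ)) * x1⁻¹ *
              x0 ^ (Q * wlen {x0, x1, c1, pi0} g) ∧
          (∀ w' : List VPerm, w' <+: w →
            δ * (wlen {x0, x1, c1, pi0} g : ℝ) <
              (wlen {x0, x1, c1, pi0} (wordEval g w') : ℝ)) := by
  have G := generatorBranches_of_represents hx0 hx1 hc1 hpi0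
  refine ⟨1 / 3, 425, 40, by norm_num, by norm_num, by norm_num, fun g hgV hN => ?_⟩
  have hg : g ∈ Subgroup.closure (generators x0 x1 c1 pi0) := G.mem_closure_of_inV hgV
  have hpos : 1 ≤ wlen {x0, x1, c1, pi0} g := by
    refine Nat.one_le_iff_ne_zero.mpr fun h => ?_
    rw [eq_one_of_wlen_eq_zero hg h] at hN
    have := nbr_one_le
    omega
  generalize hn : wlen {x0, x1, c1, pi0} g = n at hpos
  obtain ⟨k, hk⟩ : ∃ k, k + 2 = 40 * n := ⟨40 * n - 2, by omega⟩
  obtain ⟨L, hL, p⟩ := G.exists_avoidingPath hg (k := k) (by rw [hn]; omega)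
  rw [hn] at hL p
  obtain ⟨w, h1, h2, h3, h4⟩ := p.exists_wordEval
  refine ⟨w, ?_, ?_, ?_, ?_⟩
  · intro x hx
    have := h1 x hx
    simp only [IsLetter, Set.mem_insert_iff, Set.mem_singleton_iff, inv_eq_iff_eq_inv] at this
    tauto
  · rw [h2]
    have : L ≤ 425 * n := by omega
    exact_mod_cast this
  · rw [h3, ← hk]
    simp only [deepCopy, contraction, seedWord, Bool.false_eq_true, if_false, List.prod_cons,
      List.prod_nil, mul_one]
    push_cast
    group
  · intro w' hw'
    have h5 := h4 w' hw'
    have h6 : (n : ℝ) ≤ 2 * (wlen {x0, x1, c1, pi0} (wordEval g w') : ℝ) := by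
      exact_mod_cast h5
    have h7 : (1 : ℝ) ≤ n := by exact_mod_cast hpos
    linarith
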